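/- arXiv:2204.08821 — 3 statements merged into one kernel-verified Lean document; each statement's English description precedes it below -/
import Mathlib

section
/- Let n be a positive integer, let ρ and σ be density matrices on ℂ^n, and let Λ be a quantum channel from n×n to m×m complex matrices given by a finite Kraus family. Then the fidelity does not decrease under Λ: F(Λ(ρ), Λ(σ)) ≥ F(ρ, σ). -/
open Matrix BigOperators ComplexOrder Classical

/-- The positive semidefinite square root of a matrix (junk value `0` if the
matrix is not positive semidefinite). -/
noncomputable def matSqrt {n : ℕ} (A : Matrix (Fin n) (Fin n) ℂ) : Matrix (Fin n) (Fin n) ℂ :=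
  if h : A.PosSemidef then
    (h.isHermitian.eigenvectorUnitary : Matrix (Fin n) (Fin n) ℂ) *
      diagonal ((↑) ∘ Real.sqrt ∘ h.isHermitian.eigenvalues) *
      (star h.isHermitian.eigenvectorUnitary : Matrix (Fin n) (Fin n) ℂ)
  else 0

/-- The fidelity `F(ρ, σ) = Tr √(√σ ρ √σ)` of two density matrices. -/
noncomputable def fidelity {n : ℕ} (ρ σ : Matrix (Fin n) (Fin n) ℂ) : ℝ :=
  ((matSqrt (matSqrt σ * ρ * matSqrt σ)).trace).re

section MatSqrt

variable {n : ℕ} {A : Matrix (Fin n) (Fin n) ℂ}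

theorem matSqrt_posSemidef (h : A.PosSemidef) : (matSqrt A).PosSemidef := by
  have hd : (diagonal ((↑) ∘ Real.sqrt ∘ h.isHermitian.eigenvalues) :
      Matrix (Fin n) (Fin n) ℂ).PosSemidef := by
    refine PosSemidef.diagonal fun i => ?_
    simp [Real.sqrt_nonneg]
  rw [matSqrt, dif_pos h]
  exact hd.mul_mul_conjTranspose_same (h.isHermitian.eigenvectorUnitary : Matrix (Fin n) (Fin n) ℂ)

theorem matSqrt_mul_self (h : A.PosSemidef) : matSqrt A * matSqrt A = A := by
  have hU : (star h.isHermitian.eigenvectorUnitary : Matrix (Fin n) (Fin n) ℂ) *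
      (h.isHermitian.eigenvectorUnitary : Matrix (Fin n) (Fin n) ℂ) = 1 :=
    Unitary.coe_star_mul_self _
  conv_rhs => rw [h.isHermitian.spectral_theorem, Unitary.conjStarAlgAut_apply]
  rw [matSqrt, dif_pos h]
  simp only [Matrix.mul_assoc]
  rw [← Matrix.mul_assoc (star _ : Matrix (Fin n) (Fin n) ℂ), hU, Matrix.one_mul,
    ← Matrix.mul_assoc (diagonal _) (diagonal _), diagonal_mul_diagonal]
  congr 3
  funext i
  simp only [Function.comp_apply]
  rw [← Complex.ofReal_mul, Real.mul_self_sqrt (h.eigenvalues_nonneg i)]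
  rfl

end MatSqrt

section Contraction

variable {m k : Type*} [Fintype m] [Fintype k]

/-- A Hermitian matrix has a commuting Hermitian pseudo-inverse. -/
theorem Matrix.IsHermitian.exists_pseudoinverse [DecidableEq m] {S : Matrix m m ℂ} (hS : S.IsHermitian) :
    ∃ T : Matrix m m ℂ, T.IsHermitian ∧ T * S = S * T ∧ S * T * S = S ∧ T * S * T = T := by
  obtain ⟨U, e, hU, rfl⟩ : ∃ (U : Matrix m m ℂ) (e : m → ℝ), Uᴴ * U = 1 ∧
      S = U * diagonal (fun i => (e i : ℂ)) * Uᴴ :=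
    ⟨hS.eigenvectorUnitary, hS.eigenvalues, Unitary.coe_star_mul_self hS.eigenvectorUnitary,
      hS.spectral_theorem⟩
  have hconj (X Y : Matrix m m ℂ) : U * X * Uᴴ * (U * Y * Uᴴ) = U * (X * Y) * Uᴴ := by
    calc U * X * Uᴴ * (U * Y * Uᴴ) = U * X * (Uᴴ * U) * Y * Uᴴ := by
          simp only [Matrix.mul_assoc]
      _ = U * (X * Y) * Uᴴ := by rw [hU, Matrix.mul_one]; simp only [Matrix.mul_assoc]
  refine ⟨U * diagonal (fun i => ((e i : ℂ)⁻¹)) * Uᴴ, ?_, ?_, ?_, ?_⟩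
  · refine isHermitian_mul_mul_conjTranspose U (isHermitian_diagonal_of_self_adjoint _ ?_)
    ext i
    simp
  all_goals
    simp only [hconj, diagonal_mul_diagonal]
    congr 3
    funext i
    by_cases h : (e i : ℂ) = 0
    · simp [h]
    · field_simp

theorem Matrix.PosSemidef.one_sub_conjTranspose_mul_self [DecidableEq m] [DecidableEq k]
    {C : Matrix m k ℂ}
    (h : (1 - C * Cᴴ).PosSemidef) : (1 - Cᴴ * C).PosSemidef := by
  have e : 1 - Cᴴ * C = (1 - Cᴴ * C)ᴴ * (1 - Cᴴ * C) + Cᴴ * (1 - C * Cᴴ) * C := by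
    simp only [conjTranspose_sub, conjTranspose_one, conjTranspose_mul,
      conjTranspose_conjTranspose, Matrix.mul_sub, Matrix.sub_mul, Matrix.one_mul,
      Matrix.mul_one, Matrix.mul_assoc]
    abel
  rw [e]
  exact (posSemidef_conjTranspose_mul_self _).add (h.conjTranspose_mul_mul_same C)

/-- A finite-dimensional Douglas factorization lemma. -/
theorem Matrix.IsHermitian.exists_contraction [DecidableEq m] {S : Matrix m m ℂ}
    (hS : S.IsHermitian) {A : Matrix m k ℂ} (h : (S * S - A * Aᴴ).PosSemidef) :
    ∃ C : Matrix m k ℂ, A = S * C ∧ (1 - C * Cᴴ).PosSemidef ∧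
      (A * Aᴴ = S * S → C * Aᴴ = S) := by
  obtain ⟨T, hT, hcomm, hSTS, hTST⟩ := hS.exists_pseudoinverse
  have hTS : (T * S)ᴴ = T * S := by rw [conjTranspose_mul, hS.eq, hT.eq, hcomm]
  have hproj : (1 - T * S) * (S * S) = 0 := by
    rw [Matrix.sub_mul, Matrix.one_mul, hcomm, ← Matrix.mul_assoc, hSTS, sub_self]
  have hA : (1 - T * S) * A = 0 := by
    have h1 := h.mul_mul_conjTranspose_same (1 - T * S)
    rw [Matrix.mul_sub, hproj, zero_sub, Matrix.neg_mul] at h1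
    have h2 : ((1 - T * S) * A * ((1 - T * S) * A)ᴴ).PosSemidef :=
      posSemidef_self_mul_conjTranspose _
    have e : (1 - T * S) * A * ((1 - T * S) * A)ᴴ =
        (1 - T * S) * (A * Aᴴ) * (1 - T * S)ᴴ := by
      simp only [conjTranspose_mul, Matrix.mul_assoc]
    rw [← e] at h1
    have h3 := h1.trace_nonneg
    rw [trace_neg] at h3
    exact trace_mul_conjTranspose_self_eq_zero_iff.mp
      (le_antisymm (neg_nonneg.mp h3) h2.trace_nonneg)
  refine ⟨T * A, ?_, ?_, ?_⟩
  · rw [Matrix.sub_mul, Matrix.one_mul, sub_eq_zero] at hA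
    rw [← Matrix.mul_assoc, ← hcomm]
    exact hA
  · have h1 := h.mul_mul_conjTranspose_same T
    have h2 : ((1 - T * S) * (1 - T * S)ᴴ).PosSemidef := posSemidef_self_mul_conjTranspose _
    have hid : T * S * (T * S) = T * S := by rw [← Matrix.mul_assoc, hTST]
    have e : 1 - T * A * (T * A)ᴴ =
        T * (S * S - A * Aᴴ) * Tᴴ + (1 - T * S) * (1 - T * S)ᴴ := by
      have e1 : T * (S * S) * Tᴴ = T * S := by
        rw [hT.eq, ← Matrix.mul_assoc, Matrix.mul_assoc (T * S), ← hcomm, hid]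
      have e2 : (1 - T * S) * (1 - T * S)ᴴ = 1 - T * S := by
        rw [conjTranspose_sub, conjTranspose_one, hTS, Matrix.mul_sub, Matrix.mul_one,
          Matrix.sub_mul, Matrix.one_mul, hid, sub_self, sub_zero]
      rw [e2, Matrix.mul_sub, Matrix.sub_mul, e1]
      simp only [conjTranspose_mul, Matrix.mul_assoc]
      abel
    rw [e]
    exact h1.add h2
  · intro hAA
    rw [Matrix.mul_assoc, hAA, ← Matrix.mul_assoc, hcomm, hSTS]

theorem Matrix.re_trace_mul_le (X : Matrix m k ℂ) (Y : Matrix k m ℂ) :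
    (X * Y).trace.re ≤ ((X * Xᴴ).trace.re + (Yᴴ * Y).trace.re) / 2 := by
  have h := (posSemidef_self_mul_conjTranspose (X - Yᴴ)).trace_nonneg
  have h' := (Complex.le_def.mp h).1
  have e : ((Yᴴ * Xᴴ).trace).re = (X * Y).trace.re := by
    rw [← conjTranspose_mul, trace_conjTranspose]; simp
  simp only [conjTranspose_sub, conjTranspose_conjTranspose, Matrix.mul_sub, Matrix.sub_mul,
    trace_sub, Complex.sub_re, e, Complex.zero_re] at h'
  linarith

end Contraction

section Fidelity

variable {n : ℕ} {ρ σ : Matrix (Fin n) (Fin n) ℂ}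

theorem posSemidef_matSqrt_mul_mul_matSqrt (hρ : ρ.PosSemidef) (hσ : σ.PosSemidef) :
    (matSqrt σ * ρ * matSqrt σ).PosSemidef := by
  have h := hρ.mul_mul_conjTranspose_same (matSqrt σ)
  rwa [(matSqrt_posSemidef hσ).isHermitian.eq] at h

theorem matSqrt_mul_matSqrt_mul_conjTranspose (hρ : ρ.PosSemidef) (hσ : σ.PosSemidef) :
    matSqrt σ * matSqrt ρ * (matSqrt σ * matSqrt ρ)ᴴ =
      matSqrt (matSqrt σ * ρ * matSqrt σ) * matSqrt (matSqrt σ * ρ * matSqrt σ) := by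
  rw [matSqrt_mul_self (posSemidef_matSqrt_mul_mul_matSqrt hρ hσ), conjTranspose_mul,
    (matSqrt_posSemidef hσ).isHermitian.eq, (matSqrt_posSemidef hρ).isHermitian.eq]
  conv_rhs => rw [← matSqrt_mul_self hρ]
  simp only [Matrix.mul_assoc]

/-- The fidelity is attained by a pair of subfactorizations of the two matrices. -/
theorem exists_trace_eq_fidelity (hρ : ρ.PosSemidef) (hσ : σ.PosSemidef) :
    ∃ A B : Matrix (Fin n) (Fin n) ℂ, (ρ - A * Aᴴ).PosSemidef ∧ (σ - B * Bᴴ).PosSemidef ∧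
      (Aᴴ * B).trace.re = fidelity ρ σ := by
  have hP := (matSqrt_posSemidef (posSemidef_matSqrt_mul_mul_matSqrt hρ hσ)).isHermitian
  have hG := matSqrt_mul_matSqrt_mul_conjTranspose hρ hσ
  have hr := (matSqrt_posSemidef hρ).isHermitian.eq
  have hs := (matSqrt_posSemidef hσ).isHermitian.eq
  obtain ⟨C, -, hC, hCP⟩ := hP.exists_contraction (A := matSqrt σ * matSqrt ρ)
    (by rw [hG, sub_self]; exact PosSemidef.zero)
  refine ⟨matSqrt ρ * Cᴴ, matSqrt σ, ?_, ?_, ?_⟩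
  · have h := hC.one_sub_conjTranspose_mul_self.mul_mul_conjTranspose_same (matSqrt ρ)
    rw [hr, Matrix.mul_sub, Matrix.sub_mul, Matrix.mul_one, matSqrt_mul_self hρ] at h
    simpa only [conjTranspose_mul, conjTranspose_conjTranspose, hr, Matrix.mul_assoc] using h
  · rw [hs, matSqrt_mul_self hσ, sub_self]
    exact PosSemidef.zero
  · have h := hCP hG
    rw [conjTranspose_mul, hr, hs] at h
    rw [fidelity, conjTranspose_mul, conjTranspose_conjTranspose, hr, Matrix.mul_assoc, h]

/-- The overlap of any pair of subfactorizations is at most the fidelity. -/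
theorem re_trace_le_fidelity {k : Type*} [Fintype k]
    (hρ : ρ.PosSemidef) (hσ : σ.PosSemidef) {A B : Matrix (Fin n) k ℂ}
    (hA : (ρ - A * Aᴴ).PosSemidef) (hB : (σ - B * Bᴴ).PosSemidef) :
    (Aᴴ * B).trace.re ≤ fidelity ρ σ := by
  have hPp := matSqrt_posSemidef (posSemidef_matSqrt_mul_mul_matSqrt hρ hσ)
  have hG := matSqrt_mul_matSqrt_mul_conjTranspose hρ hσ
  have hr := (matSqrt_posSemidef hρ).isHermitian
  have hs := (matSqrt_posSemidef hσ).isHermitian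
  rw [← matSqrt_mul_self hρ] at hA
  rw [← matSqrt_mul_self hσ] at hB
  obtain ⟨V, rfl, hV, -⟩ := hr.exists_contraction hA
  obtain ⟨W, rfl, hW, -⟩ := hs.exists_contraction hB
  obtain ⟨C, hCG, hC, -⟩ := hPp.isHermitian.exists_contraction (A := matSqrt σ * matSqrt ρ)
    (by rw [hG, sub_self]; exact PosSemidef.zero)
  rw [fidelity]
  generalize matSqrt (matSqrt σ * ρ * matSqrt σ) = P at *
  have hQ := (matSqrt_posSemidef hPp).isHermitian.eq
  have hQQ := matSqrt_mul_self hPp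
  generalize matSqrt P = Q at *
  have hCG' : matSqrt ρ * matSqrt σ = Cᴴ * (Q * Q) := by
    have := congrArg conjTranspose hCG
    rwa [conjTranspose_mul, conjTranspose_mul, hr.eq, hs.eq, hPp.isHermitian.eq, ← hQQ] at this
  have e : ((matSqrt ρ * V)ᴴ * (matSqrt σ * W)).trace =
      (Q * W * (Vᴴ * Cᴴ * Q)).trace := by
    calc _ = (Vᴴ * (matSqrt ρ * matSqrt σ) * W).trace := by
          rw [conjTranspose_mul, hr.eq]; simp only [Matrix.mul_assoc]
      _ = ((Vᴴ * Cᴴ * Q) * (Q * W)).trace := by rw [hCG']; simp only [Matrix.mul_assoc]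
      _ = _ := trace_mul_comm _ _
  rw [e]
  refine (re_trace_mul_le _ _).trans ?_
  have h1 := (Complex.le_def.mp (hW.mul_mul_conjTranspose_same Q).trace_nonneg).1
  have h2 := (Complex.le_def.mp (hV.mul_mul_conjTranspose_same (Q * C)).trace_nonneg).1
  have h3 := (Complex.le_def.mp (hC.mul_mul_conjTranspose_same Q).trace_nonneg).1
  simp only [conjTranspose_mul, conjTranspose_conjTranspose, hQ, Matrix.mul_sub, Matrix.sub_mul,
    Matrix.mul_one, trace_sub, Complex.sub_re, Complex.zero_re, hQQ, Matrix.mul_assoc]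
    at h1 h2 h3 ⊢
  linarith

end Fidelity

section Kraus

variable {m n k κ : Type*} [Fintype n] [Fintype k] [Fintype κ]

/-- The block row whose blocks are the products `K i * A`. -/
def krausRow (K : κ → Matrix m n ℂ) (A : Matrix n k ℂ) : Matrix m (κ × k) ℂ :=
  of fun i p => (K p.1 * A) i p.2

theorem krausRow_mul_conjTranspose (K : κ → Matrix m n ℂ) (A : Matrix n k ℂ) :
    krausRow K A * (krausRow K A)ᴴ = ∑ i, K i * (A * Aᴴ) * (K i)ᴴ := by
  have e (i : κ) : K i * (A * Aᴴ) * (K i)ᴴ = (K i * A) * (K i * A)ᴴ := by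
    simp only [conjTranspose_mul, Matrix.mul_assoc]
  simp only [e]
  ext a b
  rw [Matrix.sum_apply]
  simp only [mul_apply (M := krausRow K A), mul_apply (M := K _ * A), Fintype.sum_prod_type]
  rfl

theorem trace_krausRow [Fintype m] [DecidableEq n] (K : κ → Matrix m n ℂ)
    (hK : ∑ i, (K i)ᴴ * K i = 1) (A B : Matrix n k ℂ) :
    ((krausRow K A)ᴴ * krausRow K B).trace = (Aᴴ * B).trace := by
  have e : Aᴴ * B = ∑ i, (K i * A)ᴴ * (K i * B) := by
    calc Aᴴ * B = Aᴴ * (∑ i, (K i)ᴴ * K i) * B := by rw [hK, Matrix.mul_one]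
      _ = _ := by
        simp only [Matrix.mul_sum, Matrix.sum_mul, conjTranspose_mul, Matrix.mul_assoc]
  rw [e, trace_sum]
  simp only [trace, Fintype.sum_prod_type]
  rfl

theorem Matrix.PosSemidef.sum_mul_mul_conjTranspose [Finite m] (K : κ → Matrix m n ℂ)
    {ρ : Matrix n n ℂ} (hρ : ρ.PosSemidef) : (∑ i, K i * ρ * (K i)ᴴ).PosSemidef :=
  posSemidef_sum _ fun i _ => hρ.mul_mul_conjTranspose_same (K i)

theorem posSemidef_sub_krausRow [Finite m] (K : κ → Matrix m n ℂ) {ρ : Matrix n n ℂ} {A : Matrix n k ℂ}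
    (h : (ρ - A * Aᴴ).PosSemidef) :
    (∑ i, K i * ρ * (K i)ᴴ - krausRow K A * (krausRow K A)ᴴ).PosSemidef := by
  rw [krausRow_mul_conjTranspose, ← Finset.sum_sub_distrib]
  simpa only [Matrix.mul_sub, Matrix.sub_mul] using h.sum_mul_mul_conjTranspose K

end Kraus

/-- The fidelity does not decrease under a quantum channel given by a finite
Kraus family. -/
theorem fidelity_nondecreasing_under_channel
    {n m N : ℕ} (hn : 0 < n)
    (ρ σ : Matrix (Fin n) (Fin n) ℂ)
    (hρ : ρ.PosSemidef) (hρ1 : ρ.trace = 1)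
    (hσ : σ.PosSemidef) (hσ1 : σ.trace = 1)
    (K : Fin N → Matrix (Fin m) (Fin n) ℂ)
    (hK : ∑ k, (K k)ᴴ * K k = 1) :
    fidelity (∑ k, K k * ρ * (K k)ᴴ) (∑ k, K k * σ * (K k)ᴴ) ≥ fidelity ρ σ := by
  obtain ⟨A, B, hA, hB, hAB⟩ := exists_trace_eq_fidelity hρ hσ
  rw [ge_iff_le, ← hAB, ← trace_krausRow K hK]
  exact re_trace_le_fidelity (hρ.sum_mul_mul_conjTranspose K) (hσ.sum_mul_mul_conjTranspose K)
    (posSemidef_sub_krausRow K hA) (posSemidef_sub_krausRow K hB)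
end

section
/- Let 4/9 < p < 1/2. Define the two-qubit density matrices ρ_ψ = p|00⟩⟨00| + p|11⟩⟨11| + (1−2p)|01⟩⟨01| and ρ_φ = p|Ψ⁺⟩⟨Ψ⁺| + p|00⟩⟨00| + (1−2p)|11⟩⟨11|, where Ψ⁺ = (|01⟩ + |10⟩)/√2. Then ρ_ψ is separable but ρ_φ is not separable. -/
open Matrix BigOperators ComplexOrder Kronecker

/-- A two-qubit density matrix is separable if it is a finite convex combination
of Kronecker products of pure-state projections `|x⟩⟨x| ⊗ |y⟩⟨y|`. -/
def IsSeparableState (ρ : Matrix (Fin 2 × Fin 2) (Fin 2 × Fin 2) ℂ) : Prop :=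
  ∃ (N : ℕ) (p : Fin N → ℝ) (x y : Fin N → (Fin 2 → ℂ)),
    (∀ k, 0 ≤ p k) ∧ (∑ k, p k = 1) ∧
    (∀ k, ∑ i, ‖x k i‖ ^ 2 = 1) ∧ (∀ k, ∑ i, ‖y k i‖ ^ 2 = 1) ∧
    ρ = ∑ k, (p k : ℂ) • (vecMulVec (x k) (star (x k)) ⊗ₖ vecMulVec (y k) (star (y k)))

/-- `Ψ⁺ = (|01⟩ + |10⟩)/√2`. -/
noncomputable def Ψplus : Fin 2 × Fin 2 → ℂ := fun q =>
  if q = (0, 1) then (Real.sqrt 2 : ℂ)⁻¹ else if q = (1, 0) then (Real.sqrt 2 : ℂ)⁻¹ else 0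

/-- `ρ_ψ = p|00⟩⟨00| + p|11⟩⟨11| + (1−2p)|01⟩⟨01|`. -/
noncomputable def ρψ (p : ℝ) : Matrix (Fin 2 × Fin 2) (Fin 2 × Fin 2) ℂ :=
  (p : ℂ) • Matrix.single (0, 0) (0, 0) 1 + (p : ℂ) • Matrix.single (1, 1) (1, 1) 1 +
    ((1 - 2 * p : ℝ) : ℂ) • Matrix.single (0, 1) (0, 1) 1

/-- `ρ_φ = p|Ψ⁺⟩⟨Ψ⁺| + p|00⟩⟨00| + (1−2p)|11⟩⟨11|`. -/
noncomputable def ρφ (p : ℝ) : Matrix (Fin 2 × Fin 2) (Fin 2 × Fin 2) ℂ :=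
  (p : ℂ) • vecMulVec Ψplus (star Ψplus) + (p : ℂ) • Matrix.single (0, 0) (0, 0) 1 +
    ((1 - 2 * p : ℝ) : ℂ) • Matrix.single (1, 1) (1, 1) 1

/-- The partial transpose of a matrix on a bipartite system, transposing the second factor. -/
def partialTranspose {m n R : Type*} (ρ : Matrix (m × n) (m × n) R) : Matrix (m × n) (m × n) R :=
  Matrix.of fun a b => ρ (a.1, b.2) (b.1, a.2)

/-- The Peres criterion: the partial transpose of a separable state is positive semidefinite. -/
theorem IsSeparableState.posSemidef_partialTranspose
    {ρ : Matrix (Fin 2 × Fin 2) (Fin 2 × Fin 2) ℂ} (h : IsSeparableState ρ) :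
    (partialTranspose ρ).PosSemidef := by
  obtain ⟨N, p, x, y, hp, -, -, -, rfl⟩ := h
  have key : partialTranspose
      (∑ k, (p k : ℂ) • (vecMulVec (x k) (star (x k)) ⊗ₖ vecMulVec (y k) (star (y k)))) =
      ∑ k, (p k : ℂ) • (vecMulVec (x k) (star (x k)) ⊗ₖ (vecMulVec (y k) (star (y k)))ᵀ) := by
    ext a b
    simp [partialTranspose, Matrix.sum_apply, vecMulVec_apply, mul_comm]
  rw [key]
  refine posSemidef_sum _ fun k _ => PosSemidef.smul ?_ (Complex.zero_le_real.mpr (hp k))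
  exact (posSemidef_vecMulVec_self_star _).kronecker (posSemidef_vecMulVec_self_star _).transpose

theorem isSeparableState_ρψ {p : ℝ} (h0 : 0 ≤ p) (h2 : p ≤ 1 / 2) : IsSeparableState (ρψ p) := by
  refine ⟨3, ![p, p, 1 - 2 * p], ![![1, 0], ![0, 1], ![1, 0]], ![![1, 0], ![0, 1], ![0, 1]],
    ?_, ?_, ?_, ?_, ?_⟩
  · simp only [Fin.forall_fin_succ]
    simp [h0]
    linarith
  · simp [Fin.sum_univ_succ]
    ring
  · simp [Fin.forall_fin_succ]
  · simp [Fin.forall_fin_succ]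
  · ext ⟨a, b⟩ ⟨c, d⟩
    simp only [ρψ, Fin.sum_univ_three, Matrix.add_apply, Matrix.smul_apply, kroneckerMap_apply,
      vecMulVec_apply, Pi.star_apply]
    fin_cases a <;> fin_cases b <;> fin_cases c <;> fin_cases d <;> simp

theorem not_isSeparableState_ρφ {p : ℝ} (h : 4 / 9 < p) : ¬ IsSeparableState (ρφ p) := by
  intro hs
  let v : Fin 2 × Fin 2 → ℂ := fun q => !![1, 0; 0, -2] q.1 q.2
  have hv : star v ⬝ᵥ (partialTranspose (ρφ p) *ᵥ v) = ((4 - 9 * p : ℝ) : ℂ) := by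
    have hsq : ((Real.sqrt 2 : ℂ)⁻¹) * (Real.sqrt 2 : ℂ)⁻¹ = 1 / 2 := by
      rw [← mul_inv, ← Complex.ofReal_mul, Real.mul_self_sqrt (by norm_num)]
      norm_num
    simp [v, partialTranspose, ρφ, Ψplus, dotProduct, mulVec, Fintype.sum_prod_type,
      vecMulVec_apply, Matrix.single_apply, hsq, Complex.conj_ofNat]
    ring
  have hnonneg := hs.posSemidef_partialTranspose.dotProduct_mulVec_nonneg v
  rw [hv, Complex.zero_le_real] at hnonneg
  linarith

/-- For `4/9 < p < 1/2`, `ρ_ψ` is separable but `ρ_φ` is not. -/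
theorem rhoPsi_separable_rhoPhi_entangled (p : ℝ) (h1 : 4 / 9 < p) (h2 : p < 1 / 2) :
    IsSeparableState (ρψ p) ∧ ¬ IsSeparableState (ρφ p) :=
  ⟨isSeparableState_ρψ (by linarith) h2.le, not_isSeparableState_ρφ h1⟩
end

section
/- For every p with 0 < p < 1, the two-qubit density matrix ρ = p|Φ⁺⟩⟨Φ⁺| + (1−p)|00⟩⟨00|, where Φ⁺ = (|00⟩ + |11⟩)/√2, is not separable. -/
open Matrix BigOperators ComplexOrder Kronecker

/-- `Φ⁺ = (|00⟩ + |11⟩)/√2`. -/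
noncomputable def Φplus : Fin 2 × Fin 2 → ℂ := fun q =>
  if q = (0, 0) then (Real.sqrt 2 : ℂ)⁻¹ else if q = (1, 1) then (Real.sqrt 2 : ℂ)⁻¹ else 0

/-- If a diagonal entry `⟨i l|ρ|i l⟩` of a separable state vanishes, then so does every entry
`⟨i j|ρ|k l⟩`. -/
theorem IsSeparableState.apply_eq_zero_of_diag_eq_zero
    {ρ : Matrix (Fin 2 × Fin 2) (Fin 2 × Fin 2) ℂ} (hρ : IsSeparableState ρ) {i l : Fin 2}
    (h : ρ (i, l) (i, l) = 0) (j k : Fin 2) : ρ (i, j) (k, l) = 0 := by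
  obtain ⟨N, w, x, y, hw, -, -, -, rfl⟩ := hρ
  have hdiag : ∑ m, w m * (‖x m i‖ ^ 2 * ‖y m l‖ ^ 2) = 0 := by
    simp only [Matrix.sum_apply, Matrix.smul_apply, kroneckerMap_apply, vecMulVec_apply,
      Pi.star_apply, RCLike.star_def, Complex.mul_conj', smul_eq_mul] at h
    exact_mod_cast h
  rw [Finset.sum_eq_zero_iff_of_nonneg fun m _ => mul_nonneg (hw m) (by positivity)] at hdiag
  rw [Matrix.sum_apply]
  refine Finset.sum_eq_zero fun m hm => ?_
  have hm' := hdiag m hm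
  simp only [mul_eq_zero, pow_eq_zero_iff two_ne_zero, norm_eq_zero] at hm'
  rcases hm' with h0 | h0 | h0 <;> simp [vecMulVec_apply, h0]

/-- For `0 < p < 1`, the state `p|Φ⁺⟩⟨Φ⁺| + (1−p)|00⟩⟨00|` is not separable. -/
theorem bell_mixture_with_00_entangled (p : ℝ) (h1 : 0 < p) (h2 : p < 1) :
    ¬ IsSeparableState
      ((p : ℂ) • vecMulVec Φplus (star Φplus) +
        ((1 - p : ℝ) : ℂ) • Matrix.single (0, 0) (0, 0) 1) := by
  intro hsep
  have h := hsep.apply_eq_zero_of_diag_eq_zero (i := 0) (l := 1)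
    (by simp [vecMulVec_apply, Φplus]) 0 1
  simp [vecMulVec_apply, Φplus, h1.ne'] at h
end
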